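/- Let α > 1. The set A = {x ∈ (0,1] : lim_{i→∞} d_i(x) = ∞} of points whose α-expansion digits tend to infinity has Hausdorff dimension zero. -/

import Mathlib

open Real Filter Set

/-- The first digit of the α-expansion: d_1(x) = ⌈−log_α x⌉. -/
noncomputable def dig1 (α x : ℝ) : ℕ := (Int.ceil (-(Real.logb α x))).toNat

/-- The map T generating the α-expansion. -/
noncomputable def Tmap (α : ℝ) (x : ℝ) : ℝ := α ^ dig1 α x / (α - 1) * x - 1 / (α - 1)

/-- The digits of the α-expansion: `dig α x n` is d_{n+1}(x). -/
noncomputable def dig (α x : ℝ) (n : ℕ) : ℕ := dig1 α ((Tmap α)^[n] x)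

open MeasureTheory
open scoped NNReal ENNReal Topology

/-- A subset of the union of its images under countably many contractions can be covered by
countably many pieces that are small both in diameter and in `s`-dimensional content. -/
lemma exists_cover_of_subset_iUnion_image {X : Type*} [PseudoEMetricSpace X]
    {f : ℕ → X → X} {r : ℕ → ℝ≥0} {s : ℝ} {E : Set X} (hs : 0 ≤ s)
    (hf : ∀ k, LipschitzWith (r k) (f k)) (hr : ∀ k, (r k : ℝ≥0∞) ≤ 2⁻¹)
    (hsum : ∑' k, (r k : ℝ≥0∞) ^ s ≤ 2⁻¹) (hE : E ⊆ ⋃ k, f k '' E) (n : ℕ) :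
    ∃ t : ℕ → Set X, E ⊆ ⋃ i, t i ∧ (∀ i, Metric.ediam (t i) ≤ 2⁻¹ ^ n * Metric.ediam E) ∧
      ∑' i, Metric.ediam (t i) ^ s ≤ 2⁻¹ ^ n * (∑' k, Metric.ediam (f k '' E) ^ s) := by
  induction n with
  | zero =>
    refine ⟨fun k => f k '' E, hE, fun k => ?_, by simp⟩
    calc Metric.ediam (f k '' E) ≤ r k * Metric.ediam E := (hf k).ediam_image_le E
      _ ≤ 1 * Metric.ediam E := by gcongr; exact (hr k).trans (by simp)
      _ = _ := by simp
  | succ n ih =>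
    obtain ⟨t, hcov, hdiam, hts⟩ := ih
    refine ⟨fun i => f i.unpair.1 '' t i.unpair.2, fun x hx => ?_, fun i => ?_, ?_⟩
    · obtain ⟨k, y, hy, rfl⟩ := mem_iUnion.1 (hE hx)
      obtain ⟨j, hj⟩ := mem_iUnion.1 (hcov hy)
      exact mem_iUnion.2 ⟨Nat.pair k j, by simpa using mem_image_of_mem _ hj⟩
    · calc _ ≤ r i.unpair.1 * Metric.ediam (t i.unpair.2) := (hf _).ediam_image_le _
        _ ≤ 2⁻¹ * (2⁻¹ ^ n * Metric.ediam E) := by gcongr; exacts [hr _, hdiam _]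
        _ = _ := by ring
    · calc ∑' i : ℕ, Metric.ediam (f i.unpair.1 '' t i.unpair.2) ^ s
          = ∑' p : ℕ × ℕ, Metric.ediam (f p.1 '' t p.2) ^ s :=
            Nat.pairEquiv.symm.tsum_eq
              (fun p : ℕ × ℕ => Metric.ediam (f p.1 '' t p.2) ^ s)
        _ ≤ ∑' p : ℕ × ℕ, (r p.1 : ℝ≥0∞) ^ s * Metric.ediam (t p.2) ^ s := by
            refine ENNReal.tsum_le_tsum fun p => ?_
            rw [← ENNReal.mul_rpow_of_nonneg _ _ hs]
            exact ENNReal.rpow_le_rpow ((hf _).ediam_image_le _) hs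
        _ = (∑' k, (r k : ℝ≥0∞) ^ s) * ∑' j, Metric.ediam (t j) ^ s := by
            rw [ENNReal.tsum_prod', ← ENNReal.tsum_mul_right]
            exact tsum_congr fun k =>
              ENNReal.tsum_mul_left (a := (r k : ℝ≥0∞) ^ s)
        _ ≤ 2⁻¹ * (2⁻¹ ^ n * (∑' k, Metric.ediam (f k '' E) ^ s)) := by gcongr
        _ = _ := by ring

lemma dimH_le_of_subset_iUnion_image {X : Type*} [EMetricSpace X]
    {f : ℕ → X → X} {r : ℕ → ℝ≥0} {s : ℝ≥0} {E : Set X}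
    (hf : ∀ k, LipschitzWith (r k) (f k)) (hr : ∀ k, (r k : ℝ≥0∞) ≤ 2⁻¹)
    (hsum : ∑' k, (r k : ℝ≥0∞) ^ (s : ℝ) ≤ 2⁻¹) (hE : E ⊆ ⋃ k, f k '' E)
    (hbdd : Metric.ediam E ≠ ∞) : dimH E ≤ s := by
  borelize X
  refine dimH_le_of_hausdorffMeasure_ne_top ?_
  choose t hcov hdiam hts using
    exists_cover_of_subset_iUnion_image s.coe_nonneg hf hr hsum hE
  set S := ∑' k, Metric.ediam (f k '' E) ^ (s : ℝ) with hSdef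
  have hS : S ≠ ∞ := by
    have hle : S ≤ 2⁻¹ * Metric.ediam E ^ (s : ℝ) := by
      calc S ≤ ∑' k, (r k : ℝ≥0∞) ^ (s : ℝ) * Metric.ediam E ^ (s : ℝ) := by
            refine ENNReal.tsum_le_tsum fun k => ?_
            rw [← ENNReal.mul_rpow_of_nonneg _ _ s.coe_nonneg]
            exact ENNReal.rpow_le_rpow ((hf _).ediam_image_le _) s.coe_nonneg
        _ = (∑' k, (r k : ℝ≥0∞) ^ (s : ℝ)) * Metric.ediam E ^ (s : ℝ) :=
            ENNReal.tsum_mul_right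
        _ ≤ _ := by gcongr
    exact ne_top_of_le_ne_top
      (ENNReal.mul_ne_top (by simp) (ENNReal.rpow_ne_top_of_nonneg s.coe_nonneg hbdd)) hle
  have hpow : Tendsto (fun n : ℕ => (2⁻¹ : ℝ≥0∞) ^ n * Metric.ediam E) atTop (𝓝 0) := by
    have h := ENNReal.Tendsto.mul_const (ENNReal.tendsto_pow_atTop_nhds_zero_of_lt_one
      (r := 2⁻¹) (by simp)) (Or.inr hbdd)
    simpa using h
  have key := Measure.hausdorffMeasure_le_liminf_tsum (s : ℝ) E
    (fun n : ℕ => (2⁻¹ : ℝ≥0∞) ^ n * Metric.ediam E) hpow t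
    (Eventually.of_forall hdiam) (Eventually.of_forall hcov)
  refine ne_top_of_le_ne_top hS (key.trans ?_)
  refine liminf_le_of_le (by isBoundedDefault) fun b hb => ?_
  obtain ⟨n, hn⟩ := hb.exists
  calc b ≤ 2⁻¹ ^ n * S := hn.trans (hts n)
    _ ≤ 1 * S := by gcongr; exact pow_le_one₀ (by simp) (by simp)
    _ = S := one_mul S

/-- The inverse branch of `Tmap α` on the points with first digit `d`. -/
noncomputable def invBranch (α : ℝ) (d : ℕ) (y : ℝ) : ℝ := (1 + (α - 1) * y) / α ^ d

/-- The contraction ratio of `invBranch α d`. -/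
noncomputable def branchRatio (α : ℝ) (d : ℕ) : ℝ≥0 :=
  Real.toNNReal (α - 1) * (Real.toNNReal α)⁻¹ ^ d

lemma lipschitzWith_invBranch {α : ℝ} (hα : 1 < α) (d : ℕ) :
    LipschitzWith (branchRatio α d) (invBranch α d) := by
  have hpos : 0 < α := by linarith
  refine LipschitzWith.of_dist_le_mul fun x y => le_of_eq ?_
  have hcoe : (branchRatio α d : ℝ) = (α - 1) * α⁻¹ ^ d := by
    simp [branchRatio, hα.le, hpos.le]
  rw [hcoe, Real.dist_eq, Real.dist_eq,
    show invBranch α d x - invBranch α d y = ((α - 1) * α⁻¹ ^ d) * (x - y) by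
      unfold invBranch; rw [inv_pow]; field_simp; ring,
    abs_mul, abs_of_nonneg (mul_nonneg (by linarith) (by positivity))]

lemma invBranch_dig1_Tmap {α : ℝ} (hα : 1 < α) (x : ℝ) :
    invBranch α (dig1 α x) (Tmap α x) = x := by
  have h1 : α - 1 ≠ 0 := by linarith
  have h2 : α ^ dig1 α x ≠ 0 := pow_ne_zero _ (by linarith)
  unfold invBranch Tmap
  field_simp
  ring

lemma abs_le_one_of_one_le_dig1 {α x : ℝ} (hα : 1 < α) (h : 1 ≤ dig1 α x) : |x| ≤ 1 := by
  by_contra! hx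
  have hlog : 0 ≤ Real.logb α x := by
    rw [← Real.logb_abs]
    exact Real.logb_nonneg hα hx.le
  have : dig1 α x = 0 := by
    unfold dig1
    exact Int.toNat_of_nonpos (Int.ceil_le.2 (by simpa using hlog))
  omega

lemma dimH_preimage_Tmap_iterate_le {α : ℝ} (hα : 1 < α) (E : Set ℝ) (n : ℕ) :
    dimH ((Tmap α)^[n] ⁻¹' E) ≤ dimH E := by
  induction n with
  | zero => simp
  | succ n ih =>
    have hsub : (Tmap α)^[n + 1] ⁻¹' E ⊆ ⋃ d, invBranch α d '' ((Tmap α)^[n] ⁻¹' E) :=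
      fun x hx => mem_iUnion.2 ⟨dig1 α x, Tmap α x, hx, invBranch_dig1_Tmap hα x⟩
    refine (dimH_mono hsub).trans ?_
    rw [dimH_iUnion]
    exact iSup_le fun d => ((lipschitzWith_invBranch hα d).dimH_image_le _).trans ih

lemma tsum_branchRatio_rpow_ne_top {α : ℝ} (hα : 1 < α) {s : ℝ} (hs : 0 < s) :
    ∑' d, (branchRatio α d : ℝ≥0∞) ^ s ≠ ∞ := by
  have hα' : 1 < Real.toNNReal α := by simpa using hα
  have hlt : (((Real.toNNReal α)⁻¹ : ℝ≥0) : ℝ≥0∞) ^ s < 1 :=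
    ENNReal.rpow_lt_one (by exact_mod_cast inv_lt_one_of_one_lt₀ hα') hs
  have heq : ∀ d, (branchRatio α d : ℝ≥0∞) ^ s =
      (Real.toNNReal (α - 1) : ℝ≥0∞) ^ s * ((((Real.toNNReal α)⁻¹ : ℝ≥0) : ℝ≥0∞) ^ s) ^ d := by
    intro d
    rw [branchRatio, ENNReal.coe_mul, ENNReal.mul_rpow_of_nonneg _ _ hs.le, ENNReal.coe_pow,
      ← ENNReal.rpow_natCast, ← ENNReal.rpow_natCast, ← ENNReal.rpow_mul, ← ENNReal.rpow_mul,
      mul_comm s]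
  simp_rw [heq]
  rw [ENNReal.tsum_mul_left, ENNReal.tsum_geometric]
  refine ENNReal.mul_ne_top (ENNReal.rpow_ne_top_of_nonneg hs.le (by simp)) ?_
  simpa [tsub_eq_zero_iff_le] using hlt

/-- Points all of whose digits are large form a set of small Hausdorff dimension. -/
lemma exists_dimH_le_dig {α : ℝ} (hα : 1 < α) {s : ℝ≥0} (hs : 0 < s) :
    ∃ m, dimH {x : ℝ | ∀ n, m ≤ dig α x n} ≤ s := by
  have hlim : ∀ u : ℝ, 0 < u → ∀ᶠ m in atTop,
      ∑' k, (branchRatio α (k + m) : ℝ≥0∞) ^ u ≤ 2⁻¹ := fun u hu =>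
    (ENNReal.tendsto_sum_nat_add _ (tsum_branchRatio_rpow_ne_top hα hu)).eventually_le_const
      (by simp)
  obtain ⟨m, ⟨hms, hm1⟩, hm⟩ :=
    (((hlim s (by exact_mod_cast hs)).and (hlim 1 one_pos)).and (eventually_ge_atTop 1)).exists
  refine ⟨m, dimH_le_of_subset_iUnion_image (f := fun k => invBranch α (k + m))
    (fun k => lipschitzWith_invBranch hα _) (fun k => ?_) hms (fun x hx => ?_) ?_⟩
  · simpa using (ENNReal.le_tsum k).trans hm1
  · have h0 : m ≤ dig1 α x := hx 0
    refine mem_iUnion.2 ⟨dig1 α x - m, Tmap α x, fun n => hx (n + 1), ?_⟩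
    simpa [Nat.sub_add_cancel h0] using invBranch_dig1_Tmap hα x
  · have hsub : {x : ℝ | ∀ n, m ≤ dig α x n} ⊆ Icc (-1) 1 := fun x hx =>
      abs_le.1 (abs_le_one_of_one_le_dig1 hα (hm.trans (hx 0)))
    exact ((Metric.isBounded_Icc (-1 : ℝ) 1).subset hsub).ediam_ne_top

/-- For α > 1, the set A = {x ∈ (0,1] : lim_{i→∞} d_i(x) = ∞}
has Hausdorff dimension zero. -/
theorem stmt_7 (α : ℝ) (hα : 1 < α) :
    dimH {x ∈ Set.Ioc (0 : ℝ) 1 | Tendsto (fun i => dig α x i) atTop atTop} = 0 := by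
  refine le_antisymm (ENNReal.le_of_forall_pos_le_add fun s hs _ => ?_) zero_le
  obtain ⟨m, hm⟩ := exists_dimH_le_dig hα hs
  rw [zero_add]
  have hsub : {x ∈ Set.Ioc (0 : ℝ) 1 | Tendsto (fun i => dig α x i) atTop atTop} ⊆
      ⋃ N, (Tmap α)^[N] ⁻¹' {x : ℝ | ∀ n, m ≤ dig α x n} := by
    rintro x ⟨-, hx⟩
    obtain ⟨N, hN⟩ := eventually_atTop.1 (hx.eventually_ge_atTop m)
    refine mem_iUnion.2 ⟨N, fun n => ?_⟩
    have h := hN (n + N) (Nat.le_add_left N n)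
    rwa [dig, Function.iterate_add_apply] at h
  refine (dimH_mono hsub).trans ?_
  rw [dimH_iUnion]
  exact iSup_le fun N => (dimH_preimage_Tmap_iterate_le hα _ N).trans hm
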